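/- Let f : ℝ^d → ℂ be infinitely differentiable with all iterated derivatives bounded: for every k ∈ ℕ there is C_k with ‖iteratedFDeriv ℝ k f X‖ ≤ C_k for all X ∈ ℝ^d. Let A : ℝ^d → (ℝ^d →ᵇ ℂ) be the translation map into the Banach space of bounded continuous functions with supremum norm, i.e. (A X)(y) = f(y + X). Then A is infinitely differentiable (ContDiff ℝ ∞). -/

import Mathlib

open scoped BoundedContinuousFunction

section Translation

variable {E F : Type*} [NormedAddCommGroup E] [NormedSpace ℝ E]
  [NormedAddCommGroup F] [NormedSpace ℝ F]

/-- First-order Taylor estimate with a remainder that is uniform in the base point. -/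
theorem norm_image_add_sub_fderiv_le {f : E → F} (hf : ContDiff ℝ 2 f) {C : ℝ}
    (hC : ∀ x, ‖iteratedFDeriv ℝ 2 f x‖ ≤ C) (x h : E) :
    ‖f (x + h) - f x - fderiv ℝ f x h‖ ≤ C * ‖h‖ * ‖h‖ := by
  have hC0 : 0 ≤ C := (norm_nonneg _).trans (hC x)
  have hf' : Differentiable ℝ (fderiv ℝ f) :=
    (hf.fderiv_right (m := 1) (by norm_num)).differentiable (by norm_num)
  have hbound : ∀ z, ‖fderiv ℝ (fderiv ℝ f) z‖ ≤ C := fun z ↦ by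
    rw [← norm_iteratedFDeriv_one, norm_iteratedFDeriv_fderiv]
    exact hC z
  have hlip : ∀ z ∈ Metric.closedBall x ‖h‖, ‖fderiv ℝ f z - fderiv ℝ f x‖ ≤ C * ‖h‖ := by
    intro z hz
    have := convex_univ.norm_image_sub_le_of_norm_fderiv_le (𝕜 := ℝ) (f := fderiv ℝ f)
      (fun w _ ↦ hf' w) (fun w _ ↦ hbound w) (Set.mem_univ x) (Set.mem_univ z)
    exact this.trans (mul_le_mul_of_nonneg_left (mem_closedBall_iff_norm.1 hz) hC0)
  have := (convex_closedBall x ‖h‖).norm_image_sub_le_of_norm_fderiv_le' (𝕜 := ℝ)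
    (fun w _ ↦ hf.differentiable (by norm_num) w) hlip
    (Metric.mem_closedBall_self (norm_nonneg h)) (y := x + h) (by simp)
  simpa using this

/-- The directional derivatives of a function with bounded derivatives have bounded
derivatives. -/
theorem exists_norm_iteratedFDeriv_fderiv_apply_le {f : E → F}
    (hf : ContDiff ℝ (⊤ : ℕ∞) f)
    (hbd : ∀ k : ℕ, ∃ C : ℝ, ∀ x, ‖iteratedFDeriv ℝ k f x‖ ≤ C) (v : E) (k : ℕ) :
    ∃ C : ℝ, ∀ x, ‖iteratedFDeriv ℝ k (fun z ↦ fderiv ℝ f z v) x‖ ≤ C := by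
  obtain ⟨C, hC⟩ := hbd (k + 1)
  refine ⟨‖v‖ * C, fun x ↦ ?_⟩
  have hf' : ContDiff ℝ (⊤ : ℕ∞) (fderiv ℝ f) := hf.fderiv_right (by simp)
  refine (norm_iteratedFDeriv_clm_apply_const (n := k) (N := (⊤ : ℕ∞)) hf'.contDiffAt
    (mod_cast le_top)).trans ?_
  rw [norm_iteratedFDeriv_fderiv]
  exact mul_le_mul_of_nonneg_left (hC x) (norm_nonneg v)

variable [FiniteDimensional ℝ E]

/-- The translation map of a function with bounded derivatives is differentiable in the
supremum norm, and its derivative is the translation of the derivative. -/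
theorem exists_hasFDerivAt_translation {f : E → F} (hf : ContDiff ℝ (⊤ : ℕ∞) f)
    (hbd : ∀ k : ℕ, ∃ C : ℝ, ∀ x, ‖iteratedFDeriv ℝ k f x‖ ≤ C)
    {A : E → (E →ᵇ F)} (hA : ∀ x y, A x y = f (y + x)) (x : E) :
    ∃ L : E →L[ℝ] (E →ᵇ F), HasFDerivAt A L x ∧ ∀ v y, L v y = fderiv ℝ f (y + x) v := by
  obtain ⟨C₁, hC₁⟩ := hbd 1
  obtain ⟨C₂, hC₂⟩ := hbd 2
  have hcont : Continuous (fderiv ℝ f) := hf.continuous_fderiv (by simp)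
  let L : E →ₗ[ℝ] (E →ᵇ F) :=
    { toFun v := BoundedContinuousFunction.ofNormedAddCommGroup
        (fun y ↦ fderiv ℝ f (y + x) v) (by fun_prop) (C₁ * ‖v‖) fun y ↦ by
          refine (fderiv ℝ f (y + x)).le_of_opNorm_le ?_ v
          rw [← norm_iteratedFDeriv_one]
          exact hC₁ _
      map_add' v w := by ext y; simp
      map_smul' c v := by ext y; simp }
  refine ⟨L.toContinuousLinearMap, ?_, fun v y ↦ rfl⟩
  have hC₂0 : 0 ≤ C₂ := (norm_nonneg _).trans (hC₂ x)
  have hbig : (fun h ↦ A (x + h) - A x - L.toContinuousLinearMap h)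
      =O[nhds 0] fun h : E ↦ ‖h‖ ^ 2 := by
    refine Asymptotics.IsBigO.of_bound C₂ (Filter.Eventually.of_forall fun h ↦ ?_)
    rw [BoundedContinuousFunction.norm_le (by positivity)]
    intro y
    have := norm_image_add_sub_fderiv_le (contDiff_infty.1 hf 2) hC₂ (y + x) h
    calc _ = ‖f (y + x + h) - f (y + x) - fderiv ℝ f (y + x) h‖ := by
          simp [hA, L, add_assoc]
      _ ≤ _ := this
      _ = _ := by simp; ring
  rw [hasFDerivAt_iff_isLittleO_nhds_zero]
  exact hbig.trans_isLittleO (Asymptotics.isLittleO_norm_pow_id one_lt_two)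

/-- The translation map of a function on a finite-dimensional space all of whose derivatives
are bounded is smooth in the supremum norm. -/
theorem contDiff_translation {f : E → F} (hf : ContDiff ℝ (⊤ : ℕ∞) f)
    (hbd : ∀ k : ℕ, ∃ C : ℝ, ∀ x, ‖iteratedFDeriv ℝ k f x‖ ≤ C)
    {A : E → (E →ᵇ F)} (hA : ∀ x y, A x y = f (y + x)) :
    ContDiff ℝ (⊤ : ℕ∞) A := by
  rw [contDiff_infty]
  intro n
  induction n generalizing f A with
  | zero =>
    refine contDiff_zero.2 (Differentiable.continuous (𝕜 := ℝ) fun x ↦ ?_)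
    obtain ⟨L, hL, -⟩ := exists_hasFDerivAt_translation hf hbd hA x
    exact hL.differentiableAt
  | succ n ih =>
    choose L hL hLf using exists_hasFDerivAt_translation hf hbd hA
    push_cast
    refine contDiff_succ_iff_fderiv_apply.2
      ⟨fun x ↦ (hL x).differentiableAt, by simp, fun v ↦ ?_⟩
    refine ih (f := fun z ↦ fderiv ℝ f z v) ((hf.fderiv_right (by simp)).clm_apply contDiff_const)
      (exists_norm_iteratedFDeriv_fderiv_apply_le hf hbd v) fun x y ↦ ?_
    rw [(hL x).fderiv, hLf]

end Translation

/-- If `f : ℝ^d → ℂ` is smooth with all iterated derivatives bounded, then the translation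
map `X ↦ f(· + X)` into the Banach space of bounded continuous functions (with the
supremum norm) is infinitely differentiable: every element of `BC^∞` is a smooth vector
for the translation action. -/
theorem contDiff_translation_of_contDiff_of_bounded
    {d : ℕ}
    (f : (Fin d → ℝ) → ℂ) (hf : ContDiff ℝ (⊤ : ℕ∞) f)
    (hbd : ∀ k : ℕ, ∃ C : ℝ, ∀ X : Fin d → ℝ, ‖iteratedFDeriv ℝ k f X‖ ≤ C)
    (A : (Fin d → ℝ) → ((Fin d → ℝ) →ᵇ ℂ))
    (hA : ∀ X y : Fin d → ℝ, A X y = f (y + X)) :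
    ContDiff ℝ (⊤ : ℕ∞) A := by
  exact contDiff_translation hf hbd hA
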